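/- Let a^1 = (a^1_1,…,a^1_n) ∈ V_{n,d}^α with a^1_1 ≥ 1 and a^1_n ≤ α_n − 1. Then there exists a maximal clique of 𝒢(d,α) of the form {a^1 >_lex a^2 >_lex ⋯ >_lex a^n}, i.e., a maximal clique whose lexicographically largest element is a^1. -/

import Mathlib

/-- The set `V_{n,d}^α` of nonnegative integer tuples with coordinate sum `d`
and coordinatewise bound `α`. -/
def VT (n d : ℕ) (α : Fin n → ℕ) : Set (Fin n → ℕ) :=
  {c | (∑ i, c i) = d ∧ ∀ i, c i ≤ α i}

/-- `a >_lex b`: the leftmost nonzero entry of `a - b` is positive. -/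
def lexGT {n : ℕ} (a b : Fin n → ℕ) : Prop :=
  ∃ i : Fin n, (∀ j, j < i → a j = b j) ∧ b i < a i

/-- `sort(a,b) = (a,b)` for Sturmfels' sorting operator: for every `t`, the prefix
sum of `a` up to `t` equals the ceiling of half the prefix sum of `a + b`. -/
def sortedPair {n : ℕ} (a b : Fin n → ℕ) : Prop :=
  ∀ t : Fin n, 2 * (∑ i ∈ Finset.Iic t, a i)
    = (∑ i ∈ Finset.Iic t, (a i + b i)) + (∑ i ∈ Finset.Iic t, (a i + b i)) % 2

/-- The sorting signature set `Δ(a,b)` of a sorted pair, recorded (0-indexed) as the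
set of positions `t` where the prefix sum of `b` is one less than that of `a`. -/
def sigSet {n : ℕ} (a b : Fin n → ℕ) : Finset (Fin n) :=
  Finset.univ.filter (fun t => (∑ i ∈ Finset.Iic t, b i) + 1 = ∑ i ∈ Finset.Iic t, a i)

/-- Adjacency in the sorting graph `𝒢(d,α)`. -/
def adjG {n : ℕ} (a b : Fin n → ℕ) : Prop :=
  (lexGT a b ∧ sortedPair a b) ∨ (lexGT b a ∧ sortedPair b a)

/-- A clique of the sorting graph `𝒢(d,α)`. -/
def isClique (n d : ℕ) (α : Fin n → ℕ) (S : Finset (Fin n → ℕ)) : Prop :=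
  (↑S ⊆ VT n d α) ∧ ∀ a ∈ S, ∀ b ∈ S, a ≠ b → adjG a b

/-- A maximal clique of the sorting graph `𝒢(d,α)`. -/
def isMaxClique (n d : ℕ) (α : Fin n → ℕ) (S : Finset (Fin n → ℕ)) : Prop :=
  isClique n d α S ∧ ∀ T, isClique n d α T → S ⊆ T → S = T

lemma rk_exists (p : ℕ → Prop) (m : ℕ) : ∃ rk : ℕ → ℕ,
    (∀ k < m, ∃ t < m, rk t = k) ∧ (∀ t < m, rk t < m) ∧
    (∀ s < m, ∀ t < m, rk s = rk t → s = t) ∧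
    (∀ i, i + 1 < m → (p (i+1) → rk (i+1) < rk i) ∧ (¬ p (i+1) → rk i < rk (i+1))) := by
  classical
  induction m with
  | zero => exact ⟨fun _ => 0, by simp⟩
  | succ m ih =>
    obtain ⟨rk, h1, h2, h3, h4⟩ := ih
    by_cases hp : p m
    · refine ⟨fun t => if t = m then 0 else rk t + 1, ?_, ?_, ?_, ?_⟩
      · intro k hk
        rcases k with _ | k
        · exact ⟨m, by omega, by simp⟩
        · obtain ⟨t, ht, e⟩ := h1 k (by omega)
          exact ⟨t, by omega, by simp [e]; omega⟩
      · intro t ht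
        have := h2 t
        dsimp only
        split_ifs <;> omega
      · intro s hs t ht
        have := h3 s
        dsimp only
        split_ifs with a b b
        · intro h; grind
        · intro h; grind
        · intro h; grind
        · intro h
          exact h3 s (by omega) t (by omega) (by omega)
      · intro i hi
        dsimp only
        by_cases him : i + 1 = m
        · subst him
          simp [hp]
        · have := h4 i (by omega)
          rw [if_neg him, if_neg (by omega)]
          simpa using this
    · refine ⟨fun t => if t = m then m else rk t, ?_, ?_, ?_, ?_⟩
      · intro k hk
        by_cases hkm : k = m
        · exact ⟨m, by omega, by simp [hkm]⟩
        · obtain ⟨t, ht, e⟩ := h1 k (by omega)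
          exact ⟨t, by omega, by simp [e]; omega⟩
      · intro t ht
        have := h2 t
        dsimp only
        split_ifs <;> omega
      · intro s hs t ht
        have := h2 s
        have := h2 t
        dsimp only
        split_ifs with a b b
        · intro h; grind
        · intro h; grind
        · intro h; grind
        · intro h
          exact h3 s (by omega) t (by omega) (by omega)
      · intro i hi
        dsimp only
        by_cases him : i + 1 = m
        · subst him
          have := h2 i (by omega)
          simp [hp, this]
        · have := h4 i (by omega)
          rw [if_neg him, if_neg (by omega)]
          exact this

lemma Iic_split {n : ℕ} (c : Fin n → ℕ) (t : Fin n) :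
    ∑ i ∈ Finset.Iic t, c i = ∑ i ∈ Finset.Iio t, c i + c t := by
  rw [← Finset.Iio_insert, Finset.sum_insert (by simp), add_comm]

lemma lexGT_of {n : ℕ} (a b : Fin n → ℕ)
    (h : ∀ t, ∑ i ∈ Finset.Iic t, b i ≤ ∑ i ∈ Finset.Iic t, a i) (hne : a ≠ b) :
    lexGT a b := by
  have hex : (Finset.univ.filter (fun t => a t ≠ b t)).Nonempty := by
    obtain ⟨t, ht⟩ := Function.ne_iff.1 hne
    exact ⟨t, by simpa using ht⟩
  obtain ⟨t, ht⟩ := Finset.exists_minimal hex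
  have hlt : ∀ j, j < t → a j = b j := by
    intro j hj
    by_contra hc
    have := ht.2 (y := j) (by simpa using hc) hj.le
    exact absurd hj (not_lt.2 this)
  have hta : a t ≠ b t := by simpa using ht.1
  refine ⟨t, hlt, ?_⟩
  have h' := h t
  have hs : ∑ i ∈ Finset.Iio t, a i = ∑ i ∈ Finset.Iio t, b i :=
    Finset.sum_congr rfl (fun j hj => hlt j (Finset.mem_Iio.1 hj))
  rw [Iic_split, Iic_split, hs] at h'
  omega

lemma sorted_iff {n : ℕ} (a b : Fin n → ℕ) : sortedPair a b ↔
    ∀ t, ∑ i ∈ Finset.Iic t, a i = ∑ i ∈ Finset.Iic t, b i ∨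
      ∑ i ∈ Finset.Iic t, a i = ∑ i ∈ Finset.Iic t, b i + 1 := by
  unfold sortedPair
  refine forall_congr' fun t => ?_
  rw [Finset.sum_add_distrib]
  omega

lemma eq_of_psums {n : ℕ} (a b : Fin n → ℕ)
    (h : ∀ t, ∑ i ∈ Finset.Iic t, a i = ∑ i ∈ Finset.Iic t, b i) : a = b := by
  by_contra hne
  obtain ⟨t, h1, h2⟩ := lexGT_of a b (fun t => (h t).ge) hne
  have h' := h t
  have hs : ∑ i ∈ Finset.Iio t, a i = ∑ i ∈ Finset.Iio t, b i :=
    Finset.sum_congr rfl (fun j hj => h1 j (Finset.mem_Iio.1 hj))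
  rw [Iic_split, Iic_split, hs] at h'
  omega

lemma Iic_range {n : ℕ} (f : ℕ → ℕ) (t : Fin n) :
    ∑ i ∈ Finset.Iic t, f i = ∑ i ∈ Finset.range (t + 1), f i := by
  apply Finset.sum_bij (fun (i : Fin n) _ => (i : ℕ))
  · intro i hi
    have := Fin.le_def.1 (Finset.mem_Iic.1 hi)
    simp; omega
  · intro i _ j _ h
    exact Fin.ext h
  · intro j hj
    have := Finset.mem_range.1 hj
    exact ⟨⟨j, by omega⟩, by simp [Fin.le_def]; omega, rfl⟩
  · intros; rfl

/-- prefix sums after shifting units to the right -/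
lemma psum_shift {n : ℕ} (a c : Fin n → ℕ) (e : ℕ → ℕ)
    (h : ∀ i : Fin n, c i + e i = a i + (if (i : ℕ) = 0 then 0 else e (i - 1))) (t : Fin n) :
    ∑ i ∈ Finset.Iic t, c i + e t = ∑ i ∈ Finset.Iic t, a i := by
  have h1 : ∑ i ∈ Finset.Iic t, c i + ∑ i ∈ Finset.Iic t, e i =
      ∑ i ∈ Finset.Iic t, a i + ∑ i ∈ Finset.Iic t, (if (i : ℕ) = 0 then 0 else e (i - 1)) := by
    rw [← Finset.sum_add_distrib, ← Finset.sum_add_distrib]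
    exact Finset.sum_congr rfl fun i _ => h i
  rw [Iic_range e t, Iic_range (fun i => if i = 0 then 0 else e (i - 1)) t,
    Finset.sum_range_succ, Finset.sum_range_succ'] at h1
  simp at h1
  omega

/-- If `a^1 ∈ V_{n,d}^α` with `a^1_1 ≥ 1` and `a^1_n ≤ α_n - 1`, then there is a
maximal clique of `𝒢(d,α)` of the form `a^1 >_lex a^2 >_lex ⋯ >_lex a^n`. -/
theorem stmt9 (n d : ℕ) (hn : 3 ≤ n) (α : Fin n → ℕ)
    (hα0 : 1 ≤ α ⟨0, by omega⟩) (hmono : Monotone α)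
    (hαd : ∀ i, α i ≤ d) (hdα : d < ∑ i, α i)
    (a1 : Fin n → ℕ) (ha1 : a1 ∈ VT n d α)
    (h1 : 1 ≤ a1 ⟨0, by omega⟩)
    (h2 : a1 ⟨n - 1, by omega⟩ + 1 ≤ α ⟨n - 1, by omega⟩) :
    ∃ A : Fin n → (Fin n → ℕ), A ⟨0, by omega⟩ = a1 ∧
      (∀ i j : Fin n, i < j → lexGT (A i) (A j)) ∧
      isMaxClique n d α (Finset.image A Finset.univ) := by
  classical
  obtain ⟨m, rfl⟩ : ∃ m, n = m + 1 := ⟨n - 1, by omega⟩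
  obtain ⟨ha1s, ha1b⟩ := ha1
  have hα1 : ∀ i, 1 ≤ α i := fun i => hα0.trans (hmono (Fin.le_def.2 (Nat.zero_le _)))
  obtain ⟨rk, r1, r2, r3, r4⟩ := rk_exists (fun i => ∃ h : i < m + 1, 1 ≤ a1 ⟨i, h⟩) m
  let e : ℕ → ℕ → ℕ := fun k t => if t < m ∧ rk t < k then 1 else 0
  have he1 : ∀ k t, e k t ≤ 1 := by
    intro k t; simp only [e]; split_ifs <;> omega
  let A : Fin (m+1) → Fin (m+1) → ℕ := fun k i =>
    a1 i + (if (i : ℕ) = 0 then 0 else e k (i - 1)) - e k i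
  have key : ∀ k i : Fin (m+1),
      A k i + e k i = a1 i + (if (i : ℕ) = 0 then 0 else e k (i - 1)) ∧ A k i ≤ α i := by
    intro k i
    obtain ⟨i, hi⟩ := i
    have hb := ha1b ⟨i, hi⟩
    have hk := he1 k i
    have h1' := hα1 ⟨i, hi⟩
    simp only [A]
    rcases i with _ | i
    · have h1 : 1 ≤ a1 ⟨0, hi⟩ := h1
      simp only [if_true]
      omega
    · simp only [Nat.add_eq_zero_iff, one_ne_zero, and_false, if_false, Nat.add_sub_cancel]
      have hk' := he1 k i
      by_cases him : i + 1 = m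
      · have h2 : a1 ⟨i+1, hi⟩ + 1 ≤ α ⟨i+1, hi⟩ := by
          subst him; exact h2
        have : e k (i+1) = 0 := by simp [e, him]
        omega
      · obtain ⟨q1, q2⟩ := r4 i (by omega)
        by_cases hp : 1 ≤ a1 ⟨i+1, hi⟩
        · have q := q1 ⟨hi, hp⟩
          have : e k i ≤ e k (i+1) := by
            simp only [e]; split_ifs <;> omega
          omega
        · have q := q2 (by rintro ⟨_, h⟩; exact hp h)
          have : e k (i+1) ≤ e k i := by
            simp only [e]; split_ifs <;> omega
          omega
  have hP : ∀ k t : Fin (m+1), ∑ i ∈ Finset.Iic t, A k i + e k t = ∑ i ∈ Finset.Iic t, a1 i :=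
    fun k t => psum_shift a1 (A k) (e k) (fun i => (key k i).1) t
  have hIic : ∀ c : Fin (m+1) → ℕ, ∑ i ∈ Finset.Iic (Fin.last m), c i = ∑ i, c i := by
    intro c
    congr 1
    ext i; simp [Fin.le_last]
  have hV : ∀ k, A k ∈ VT (m+1) d α := by
    intro k
    refine ⟨?_, fun i => (key k i).2⟩
    have := hP k (Fin.last m)
    rw [hIic, hIic] at this
    have h0 : e k (Fin.last m : Fin (m+1)) = 0 := by simp [e]
    omega
  have emono : ∀ k l t : ℕ, k ≤ l → e k t ≤ e l t := by
    intro k l t h; simp only [e]; split_ifs <;> omega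
  have hlex : ∀ i j : Fin (m+1), i < j → lexGT (A i) (A j) := by
    intro i j hij
    have hij' := Fin.lt_def.1 hij
    apply lexGT_of
    · intro t
      have := hP i t
      have := hP j t
      have := emono i j t hij'.le
      omega
    · intro heq
      obtain ⟨t, ht, hr⟩ := r1 i (by omega)
      have q1 := hP i ⟨t, by omega⟩
      have q2 := hP j ⟨t, by omega⟩
      rw [heq] at q1
      have e1 : e i t = 0 := by simp [e, hr]
      have e2 : e j t = 1 := by simp [e, hr, ht, hij]
      simp only at q1 q2
      omega
  have hsort : ∀ i j : Fin (m+1), i < j → sortedPair (A i) (A j) := by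
    intro i j hij
    have hij' := Fin.lt_def.1 hij
    rw [sorted_iff]
    intro t
    have := hP i t
    have := hP j t
    have := emono i j t hij'.le
    have := he1 j t
    omega
  have e0 : ∀ t, e 0 t = 0 := by intro t; simp [e]
  have em : ∀ t < m, e m t = 1 := by intro t ht; simp [e, ht, r2 t ht]
  refine ⟨A, ?_, hlex, ⟨?_, ?_⟩, ?_⟩
  · funext i
    have := (key ⟨0, by omega⟩ i).1
    simp only [e0] at this
    simpa using this
  · intro x hx
    simp only [Finset.coe_image, Finset.coe_univ, Set.image_univ, Set.mem_range] at hx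
    obtain ⟨k, rfl⟩ := hx
    exact hV k
  · intro a ha b hb hab
    simp only [Finset.mem_image, Finset.mem_univ, true_and] at ha hb
    obtain ⟨i, rfl⟩ := ha
    obtain ⟨j, rfl⟩ := hb
    rcases lt_trichotomy i j with h | h | h
    · exact Or.inl ⟨hlex _ _ h, hsort _ _ h⟩
    · exact absurd (by rw [h]) hab
    · exact Or.inr ⟨hlex _ _ h, hsort _ _ h⟩
  · intro T hT hST
    refine Finset.Subset.antisymm hST ?_
    intro x hx
    by_contra hxS
    have hxne : ∀ k, x ≠ A k := by
      rintro k rfl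
      exact hxS (Finset.mem_image_of_mem _ (Finset.mem_univ _))
    have hadj : ∀ k, sortedPair (A k) x ∨ sortedPair x (A k) := by
      intro k
      rcases hT.2 (A k) (hST (Finset.mem_image_of_mem _ (Finset.mem_univ _))) x hx
        (hxne k).symm with h | h
      · exact Or.inl h.2
      · exact Or.inr h.2
    simp only [sorted_iff] at hadj
    have hxV : ∑ i, x i = d := (hT.1 hx).1
    have hdiff : ∀ k, ∃ t : Fin (m+1), (t : ℕ) < m ∧
        ∑ i ∈ Finset.Iic t, x i ≠ ∑ i ∈ Finset.Iic t, A k i := by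
      intro k
      by_contra hc
      push Not at hc
      apply hxne k
      apply eq_of_psums
      intro t
      by_cases ht : (t : ℕ) < m
      · exact hc t ht
      · have : t = Fin.last m := Fin.ext (by simp; omega)
        rw [this, hIic, hIic, hxV, (hV k).1]
    -- `x` lies below every `A k`
    have hall : ∀ k : ℕ, (hk : k < m + 1) → ∀ t : Fin (m+1),
        ∑ i ∈ Finset.Iic t, x i ≤ ∑ i ∈ Finset.Iic t, A ⟨k, hk⟩ i := by
      intro k
      induction k with
      | zero =>
        intro hk
        rcases hadj ⟨0, hk⟩ with h | h
        · intro t; have := h t; omega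
        · exfalso
          obtain ⟨t, ht, hne⟩ := hdiff ⟨0, hk⟩
          have q0 := hP ⟨0, hk⟩ t
          have q1 := hP ⟨m, by omega⟩ t
          have q2 := h t
          have q3 := hadj ⟨m, by omega⟩
          have q4 : (∑ i ∈ Finset.Iic t, A ⟨m, by omega⟩ i = ∑ i ∈ Finset.Iic t, x i ∨
              ∑ i ∈ Finset.Iic t, A ⟨m, by omega⟩ i = ∑ i ∈ Finset.Iic t, x i + 1) ∨
              (∑ i ∈ Finset.Iic t, x i = ∑ i ∈ Finset.Iic t, A ⟨m, by omega⟩ i ∨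
              ∑ i ∈ Finset.Iic t, x i = ∑ i ∈ Finset.Iic t, A ⟨m, by omega⟩ i + 1) :=
            q3.imp (fun h => h t) (fun h => h t)
          have z0 := e0 t
          have z1 := em t ht
          simp only at q0 q1
          omega
      | succ k ih =>
        intro hk
        have ih := ih (by omega)
        rcases hadj ⟨k+1, hk⟩ with h | h
        · intro t; have := h t; omega
        · exfalso
          obtain ⟨t, ht, hne⟩ := hdiff ⟨k+1, hk⟩
          obtain ⟨s, hs, hne'⟩ := hdiff ⟨k, by omega⟩
          have a1 := hP ⟨k, by omega⟩ t
          have a2 := hP ⟨k+1, hk⟩ t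
          have a3 := hP ⟨k, by omega⟩ s
          have a4 := hP ⟨k+1, hk⟩ s
          have b1 := h t
          have b2 := h s
          have b3 := ih t
          have b4 := ih s
          have c : ∀ u < m, e k u < e (k+1) u → rk u = k := by
            intro u hu; simp only [e]; split_ifs <;> omega
          have d1 := he1 (k+1) t
          have d2 := he1 (k+1) s
          simp only at a1 a2 a3 a4
          have c1 := c t ht (by omega)
          have c2 := c s hs (by omega)
          have : t = s := Fin.ext (r3 t ht s hs (by omega))
          subst this
          omega
    obtain ⟨t, ht, hne⟩ := hdiff ⟨m, by omega⟩
    have q0 := hP ⟨0, by omega⟩ t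
    have q1 := hP ⟨m, by omega⟩ t
    have q2 := hall m (by omega) t
    have q4 : (∑ i ∈ Finset.Iic t, A ⟨0, by omega⟩ i = ∑ i ∈ Finset.Iic t, x i ∨
        ∑ i ∈ Finset.Iic t, A ⟨0, by omega⟩ i = ∑ i ∈ Finset.Iic t, x i + 1) ∨
        (∑ i ∈ Finset.Iic t, x i = ∑ i ∈ Finset.Iic t, A ⟨0, by omega⟩ i ∨
        ∑ i ∈ Finset.Iic t, x i = ∑ i ∈ Finset.Iic t, A ⟨0, by omega⟩ i + 1) :=
      (hadj ⟨0, by omega⟩).imp (fun h => h t) (fun h => h t)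
    have z0 := e0 t
    have z1 := em t ht
    simp only at q0 q1
    omega
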